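/- arXiv:1610.01998 — 3 statements merged into one kernel-verified Lean document; each statement's English description precedes it below -/
import Mathlib

section
/- For every real λ with 0 < λ ≤ 1/2 and every integer n ≥ 1: if n is odd, then every common function of X and Z with respect to the (X,Z)-marginal of the origami distribution b^{(n,λ)} is trivial; if n is even, then every common function of Y and Z with respect to the (Y,Z)-marginal of b^{(n,λ)} is trivial. (Proposition 1, part 2, triviality half: for odd n the maximal common information J_{XZ} is trivial, and for even n the maximal common information J_{YZ} is trivial.) -/
/-- The "fold" permutation σ_t : shifts odd values by ±t (within blocks of size 2t),
fixes even values. -/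
def origamiSig (t k : ℕ) : ℕ :=
  if k % 2 = 1 then (if k % (2 * t) < t then k + t else k - t) else k

/-- The map producing the new block `T_n` from `S_n`. -/
def origamiFold (n : ℕ) (s : Finset (ℕ × ℕ × ℕ)) : Finset (ℕ × ℕ × ℕ) :=
  if n % 2 = 1 then
    s.image (fun p =>
      (p.1 + 2 ^ ((n + 3) / 2), origamiSig (2 ^ ((n + 1) / 2)) p.2.1, p.2.2 + 2 ^ (n + 1)))
  else
    s.image (fun p =>
      (origamiSig (2 ^ (n / 2 + 1)) p.1, p.2.1 + 2 ^ (n / 2 + 1), p.2.2 + 2 ^ (n + 1)))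

/-- The support `S_n` of the origami distribution. -/
def origamiS : ℕ → Finset (ℕ × ℕ × ℕ)
  | 0 => ∅
  | 1 => {(0,0,0), (1,1,0), (3,0,1), (2,1,1), (0,2,2), (3,3,2), (2,3,3), (1,2,3)}
  | (n + 2) => origamiS (n + 1) ∪ origamiFold (n + 1) (origamiS (n + 1))

/-- The origami distribution `b^{(n,λ)}` on ℕ³: probability `2^{-(n+1)}·λ` on points of
`S_n` with even `x`, `2^{-(n+1)}·(1-λ)` on points of `S_n` with odd `x`, and `0` elsewhere. -/
noncomputable def origamiB (n : ℕ) (lam : ℝ) (p : ℕ × ℕ × ℕ) : ℝ :=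
  if p ∈ origamiS n then (if p.1 % 2 = 0 then lam else 1 - lam) / 2 ^ (n + 1) else 0

/-- A bipartite relation is trivially linked if every common function of its two sides is
constant on the left support. -/
def TriviallyLinked (R : ℕ → ℕ → Prop) : Prop :=
  ∀ f g : ℕ → ℕ, (∀ x z, R x z → f x = g z) → ∀ x x' z z', R x z → R x' z' → f x = f x'

/-- The invariant carried along the recursion: left values are below `M`, the left values
`0` and `1` share the right neighbour `0`, and every common function is trivial. -/
structure FoldReady (M : ℕ) (R : ℕ → ℕ → Prop) : Prop where
  lt : ∀ x z, R x z → x < M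
  zero : R 0 0
  one : R 1 0
  linked : TriviallyLinked R

/-- Shifting a relation by `M` on the left and then folding with `origamiSig M`
preserves the invariant, with `M` doubled. -/
theorem FoldReady.shift_fold {M a b : ℕ} {R R' R'' : ℕ → ℕ → Prop} (hM : 2 ≤ M)
    (hR : FoldReady M R)
    (hR' : ∀ x z, R' x z ↔ R x z ∨ ∃ x' z', R x' z' ∧ x' + M = x ∧ z' + a = z)
    (hR'' : ∀ x z, R'' x z ↔ R' x z ∨ ∃ x' z', R' x' z' ∧ origamiSig M x' = x ∧ z' + b = z) :
    FoldReady (2 * M) R'' := by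
  have sig_low : ∀ x, x < M → origamiSig M x = x ∨ origamiSig M x = x + M := by
    intro x hx
    have : x % (2 * M) = x := Nat.mod_eq_of_lt (by omega)
    unfold origamiSig
    rw [this]
    split_ifs <;> simp
  have sig_high : ∀ x, x < M → origamiSig M (x + M) = x + M ∨ origamiSig M (x + M) = x := by
    intro x hx
    have : (x + M) % (2 * M) = x + M := Nat.mod_eq_of_lt (by omega)
    unfold origamiSig
    rw [this]
    split_ifs <;> simp
    omega
  have sig_zero : origamiSig M 0 = 0 := by simp [origamiSig]
  have sig_one : origamiSig M 1 = 1 + M := by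
    have : 1 % (2 * M) = 1 := Nat.mod_eq_of_lt (by omega)
    unfold origamiSig
    rw [this]
    simp
    omega
  have left : ∀ x z, R x z → R'' x z := fun x z h => (hR'' x z).2 (.inl ((hR' x z).2 (.inl h)))
  have right : ∀ x z, R x z → R'' (x + M) (z + a) := fun x z h =>
    (hR'' _ _).2 (.inl ((hR' _ _).2 (.inr ⟨x, z, h, rfl, rfl⟩)))
  have support : ∀ x z, R'' x z → ∃ x₀ z₀, R x₀ z₀ ∧ (x = x₀ ∨ x = x₀ + M) := by
    intro x z h
    rcases (hR'' x z).1 h with h' | ⟨x', z', h', rfl, -⟩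
    · rcases (hR' x z).1 h' with h₀ | ⟨x₀, z₀, h₀, rfl, -⟩
      · exact ⟨x, z, h₀, .inl rfl⟩
      · exact ⟨x₀, z₀, h₀, .inr rfl⟩
    · rcases (hR' x' z').1 h' with h₀ | ⟨x₀, z₀, h₀, rfl, -⟩
      · exact ⟨x', z', h₀, sig_low x' (hR.lt _ _ h₀)⟩
      · exact ⟨x₀, z₀, h₀, (sig_high x₀ (hR.lt _ _ h₀)).symm⟩
  refine ⟨?_, left _ _ hR.zero, left _ _ hR.one, ?_⟩
  · intro x z h
    obtain ⟨x₀, z₀, h₀, hx⟩ := support x z h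
    have := hR.lt _ _ h₀
    omega
  · intro f g hfg
    have low : ∀ x z, R x z → f x = f 0 := fun x z h =>
      hR.linked f g (fun x z h => hfg x z (left x z h)) _ _ _ _ h hR.zero
    have high : ∀ x z, R x z → f (x + M) = f (1 + M) := fun x z h =>
      hR.linked (fun x => f (x + M)) (fun z => g (z + a))
        (fun x z h => hfg _ _ (right x z h)) _ _ _ _ h hR.one
    have bridge_zero : f 0 = g (0 + b) :=
      hfg _ _ ((hR'' _ _).2 (.inr ⟨0, 0, (hR' _ _).2 (.inl hR.zero), sig_zero, rfl⟩))
    have bridge_one : f (1 + M) = g (0 + b) :=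
      hfg _ _ ((hR'' _ _).2 (.inr ⟨1, 0, (hR' _ _).2 (.inl hR.one), sig_one, rfl⟩))
    have const : ∀ x z, R'' x z → f x = f 0 := by
      intro x z h
      obtain ⟨x₀, z₀, h₀, rfl | rfl⟩ := support x z h
      · exact low _ _ h₀
      · rw [high _ _ h₀, bridge_one, bridge_zero]
    intro x x' z z' h h'
    rw [const x z h, const x' z' h']

/-- The support of the `(X, Z)`-marginal. -/
def origamiXZ (n x z : ℕ) : Prop := ∃ y, (x, y, z) ∈ origamiS n

/-- The support of the `(Y, Z)`-marginal. -/
def origamiYZ (n y z : ℕ) : Prop := ∃ x, (x, y, z) ∈ origamiS n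

theorem mem_origamiS_even_succ (k : ℕ) (p : ℕ × ℕ × ℕ) :
    p ∈ origamiS (2 * k + 2) ↔ p ∈ origamiS (2 * k + 1) ∨
      ∃ q ∈ origamiS (2 * k + 1), (q.1 + 2 ^ (k + 2), origamiSig (2 ^ (k + 1)) q.2.1,
        q.2.2 + 2 ^ (2 * k + 2)) = p := by
  have h₁ : (2 * k + 1) % 2 = 1 := by omega
  have h₂ : (2 * k + 1 + 3) / 2 = k + 2 := by omega
  have h₃ : (2 * k + 1 + 1) / 2 = k + 1 := by omega
  rw [origamiS, origamiFold, if_pos h₁, h₂, h₃, Finset.mem_union, Finset.mem_image]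

theorem mem_origamiS_odd_succ (k : ℕ) (p : ℕ × ℕ × ℕ) :
    p ∈ origamiS (2 * k + 3) ↔ p ∈ origamiS (2 * k + 2) ∨
      ∃ q ∈ origamiS (2 * k + 2), (origamiSig (2 ^ (k + 2)) q.1, q.2.1 + 2 ^ (k + 2),
        q.2.2 + 2 ^ (2 * k + 3)) = p := by
  have h₁ : ¬ (2 * k + 2) % 2 = 1 := by omega
  have h₂ : (2 * k + 2) / 2 + 1 = k + 2 := by omega
  rw [origamiS, origamiFold, if_neg h₁]
  simp only [Nat.add_assoc, Nat.reduceAdd] at h₂ ⊢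
  rw [h₂, Finset.mem_union, Finset.mem_image]

theorem origamiXZ_even_succ (k x z : ℕ) :
    origamiXZ (2 * k + 2) x z ↔ origamiXZ (2 * k + 1) x z ∨
      ∃ x' z', origamiXZ (2 * k + 1) x' z' ∧ x' + 2 ^ (k + 2) = x ∧
        z' + 2 ^ (2 * k + 2) = z := by
  simp only [origamiXZ, mem_origamiS_even_succ, Prod.exists, Prod.mk.injEq]
  grind

theorem origamiXZ_odd_succ (k x z : ℕ) :
    origamiXZ (2 * k + 3) x z ↔ origamiXZ (2 * k + 2) x z ∨
      ∃ x' z', origamiXZ (2 * k + 2) x' z' ∧ origamiSig (2 ^ (k + 2)) x' = x ∧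
        z' + 2 ^ (2 * k + 3) = z := by
  simp only [origamiXZ, mem_origamiS_odd_succ, Prod.exists, Prod.mk.injEq]
  grind

theorem origamiYZ_even_succ (k y z : ℕ) :
    origamiYZ (2 * k + 2) y z ↔ origamiYZ (2 * k + 1) y z ∨
      ∃ y' z', origamiYZ (2 * k + 1) y' z' ∧ origamiSig (2 ^ (k + 1)) y' = y ∧
        z' + 2 ^ (2 * k + 2) = z := by
  simp only [origamiYZ, mem_origamiS_even_succ, Prod.exists, Prod.mk.injEq]
  grind

theorem origamiYZ_odd_succ (k y z : ℕ) :
    origamiYZ (2 * k + 3) y z ↔ origamiYZ (2 * k + 2) y z ∨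
      ∃ y' z', origamiYZ (2 * k + 2) y' z' ∧ y' + 2 ^ (k + 2) = y ∧
        z' + 2 ^ (2 * k + 3) = z := by
  simp only [origamiYZ, mem_origamiS_odd_succ, Prod.exists, Prod.mk.injEq]
  grind

theorem triviallyLinked_of_path {R : ℕ → ℕ → Prop} (hlt : ∀ x z, R x z → x < 4)
    (h : ∀ x < 3, ∃ z, R x z ∧ R (x + 1) z) : TriviallyLinked R := by
  intro f g hfg
  have step : ∀ x < 3, f x = f (x + 1) := fun x hx =>
    let ⟨z, h₁, h₂⟩ := h x hx
    (hfg _ _ h₁).trans (hfg _ _ h₂).symm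
  have h₀ := step 0 (by omega)
  have h₁ := step 1 (by omega)
  have h₂ := step 2 (by omega)
  have const : ∀ x z, R x z → f x = f 0 := by
    intro x z hx
    have := hlt x z hx
    interval_cases x <;> simp_all
  intro x x' z z' hx hx'
  rw [const x z hx, const x' z' hx']

theorem foldReady_origamiXZ_one : FoldReady 4 (origamiXZ 1) := by
  have hlt : ∀ x z, origamiXZ 1 x z → x < 4 := by
    rintro x z ⟨y, h⟩
    have : ∀ p ∈ origamiS 1, p.1 < 4 := by decide
    exact this _ h
  refine ⟨hlt, ⟨0, by decide⟩, ⟨1, by decide⟩, triviallyLinked_of_path hlt ?_⟩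
  intro x hx
  interval_cases x
  · exact ⟨0, ⟨0, by decide⟩, ⟨1, by decide⟩⟩
  · exact ⟨3, ⟨2, by decide⟩, ⟨3, by decide⟩⟩
  · exact ⟨1, ⟨1, by decide⟩, ⟨0, by decide⟩⟩

theorem foldReady_origamiYZ_two : FoldReady 4 (origamiYZ 2) := by
  have hlt : ∀ y z, origamiYZ 2 y z → y < 4 := by
    rintro y z ⟨x, h⟩
    have : ∀ p ∈ origamiS 2, p.2.1 < 4 := by decide
    exact this _ h
  refine ⟨hlt, ⟨0, by decide⟩, ⟨1, by decide⟩, triviallyLinked_of_path hlt ?_⟩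
  intro y hy
  interval_cases y
  · exact ⟨0, ⟨0, by decide⟩, ⟨1, by decide⟩⟩
  · exact ⟨6, ⟨7, by decide⟩, ⟨4, by decide⟩⟩
  · exact ⟨2, ⟨0, by decide⟩, ⟨3, by decide⟩⟩

theorem two_le_two_pow_add_two (k : ℕ) : 2 ≤ 2 ^ (k + 2) := by
  have := Nat.one_le_two_pow (n := k)
  rw [pow_add]
  omega

theorem foldReady_origamiXZ (k : ℕ) : FoldReady (2 ^ (k + 2)) (origamiXZ (2 * k + 1)) := by
  induction k with
  | zero => exact foldReady_origamiXZ_one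
  | succ k ih =>
    have := ih.shift_fold (two_le_two_pow_add_two k) (origamiXZ_even_succ k)
      (origamiXZ_odd_succ k)
    rwa [← pow_succ'] at this

theorem foldReady_origamiYZ (k : ℕ) : FoldReady (2 ^ (k + 2)) (origamiYZ (2 * k + 2)) := by
  induction k with
  | zero => exact foldReady_origamiYZ_two
  | succ k ih =>
    have := ih.shift_fold (two_le_two_pow_add_two k) (origamiYZ_odd_succ k)
      (origamiYZ_even_succ (k + 1))
    rwa [← pow_succ'] at this

theorem origamiB_nonneg (n : ℕ) {lam : ℝ} (h₀ : 0 < lam) (h₁ : lam ≤ 1 / 2)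
    (p : ℕ × ℕ × ℕ) : 0 ≤ origamiB n lam p := by
  unfold origamiB
  split_ifs
  · positivity
  · exact div_nonneg (by linarith) (by positivity)
  · exact le_rfl

theorem origamiB_pos {n : ℕ} {lam : ℝ} (h₀ : 0 < lam) (h₁ : lam ≤ 1 / 2)
    {p : ℕ × ℕ × ℕ} (hp : p ∈ origamiS n) : 0 < origamiB n lam p := by
  unfold origamiB
  rw [if_pos hp]
  split_ifs
  · positivity
  · exact div_pos (by linarith) (by positivity)

theorem mem_of_origamiB_ne_zero {n : ℕ} {lam : ℝ} {p : ℕ × ℕ × ℕ}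
    (h : origamiB n lam p ≠ 0) : p ∈ origamiS n := by
  by_contra hp
  exact h (if_neg hp)

theorem exists_ne_zero_of_tsum_ne_zero {F : ℕ → ℝ} (h : ∑' i, F i ≠ 0) : ∃ i, F i ≠ 0 := by
  by_contra! hF
  exact h (by simp [hF])

theorem tsum_origamiB_pos {n : ℕ} {lam : ℝ} (h₀ : 0 < lam) (h₁ : lam ≤ 1 / 2)
    {e : ℕ → ℕ × ℕ × ℕ} (he : Function.Injective e) {i : ℕ} (hi : e i ∈ origamiS n) :
    0 < ∑' j, origamiB n lam (e j) := by
  have hfin : (Function.support fun j => origamiB n lam (e j)).Finite :=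
    ((origamiS n).finite_toSet.preimage he.injOn).subset fun j hj =>
      mem_of_origamiB_ne_zero hj
  exact (summable_of_hasFiniteSupport hfin).tsum_pos (fun j => origamiB_nonneg n h₀ h₁ _) i
    (origamiB_pos h₀ h₁ hi)

/-- **Proposition 1, part 2 (triviality half).** For odd `n` every common function of `X`
and `Z` with respect to the `(X,Z)`-marginal of `b^{(n,λ)}` is trivial, and for even `n`
every common function of `Y` and `Z` with respect to the `(Y,Z)`-marginal is trivial. -/
theorem origami_JXZ_JYZ_trivial
    (n : ℕ) (hn : 1 ≤ n) (lam : ℝ) (hlam0 : 0 < lam) (hlam1 : lam ≤ 1 / 2) :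
    (Odd n → ∀ f g : ℕ → ℕ,
      (∀ x z : ℕ, (0 < ∑' y : ℕ, origamiB n lam (x, y, z)) → f x = g z) →
      ∀ x x' : ℕ,
        (0 < ∑' z : ℕ, ∑' y : ℕ, origamiB n lam (x, y, z)) →
        (0 < ∑' z : ℕ, ∑' y : ℕ, origamiB n lam (x', y, z)) →
        f x = f x') ∧
    (Even n → ∀ f g : ℕ → ℕ,
      (∀ y z : ℕ, (0 < ∑' x : ℕ, origamiB n lam (x, y, z)) → f y = g z) →
      ∀ y y' : ℕ,
        (0 < ∑' z : ℕ, ∑' x : ℕ, origamiB n lam (x, y, z)) →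
        (0 < ∑' z : ℕ, ∑' x : ℕ, origamiB n lam (x, y', z)) →
        f y = f y') := by
  constructor
  · rintro ⟨k, rfl⟩ f g hfg x x' hx hx'
    have support : ∀ x, (0 < ∑' z : ℕ, ∑' y : ℕ, origamiB (2 * k + 1) lam (x, y, z)) →
        ∃ z, origamiXZ (2 * k + 1) x z := by
      intro x hx
      obtain ⟨z, hz⟩ := exists_ne_zero_of_tsum_ne_zero hx.ne'
      obtain ⟨y, hy⟩ := exists_ne_zero_of_tsum_ne_zero hz
      exact ⟨z, y, mem_of_origamiB_ne_zero hy⟩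
    obtain ⟨z, hz⟩ := support x hx
    obtain ⟨z', hz'⟩ := support x' hx'
    refine (foldReady_origamiXZ k).linked f g (fun x z h => hfg x z ?_) x x' z z' hz hz'
    obtain ⟨y, hy⟩ := h
    exact tsum_origamiB_pos (e := fun y => (x, y, z)) hlam0 hlam1
      (fun _ _ h => by simpa using h) hy
  · rintro ⟨m, hm⟩ f g hfg y y' hy hy'
    obtain ⟨k, rfl⟩ : ∃ k, n = 2 * k + 2 := ⟨m - 1, by omega⟩
    have support : ∀ y, (0 < ∑' z : ℕ, ∑' x : ℕ, origamiB (2 * k + 2) lam (x, y, z)) →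
        ∃ z, origamiYZ (2 * k + 2) y z := by
      intro y hy
      obtain ⟨z, hz⟩ := exists_ne_zero_of_tsum_ne_zero hy.ne'
      obtain ⟨x, hx⟩ := exists_ne_zero_of_tsum_ne_zero hz
      exact ⟨z, x, mem_of_origamiB_ne_zero hx⟩
    obtain ⟨z, hz⟩ := support y hy
    obtain ⟨z', hz'⟩ := support y' hy'
    refine (foldReady_origamiYZ k).linked f g (fun y z h => hfg y z ?_) y y' z z' hz hz'
    obtain ⟨x, hx⟩ := h
    exact tsum_origamiB_pos (e := fun x => (x, y, z)) hlam0 hlam1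
      (fun _ _ h => by simpa using h) hx
end

section
/- For every integer n ≥ 1 and every real λ with 0 < λ < 1 (in particular 0 < λ ≤ 1/2), the conditional mutual information of the origami distribution b^{(n,λ)} equals the binary entropy of λ: writing p = b^{(n,λ)}, p_Z(z) = Σ_{x,y} p(x,y,z), p_{XZ}(x,z) = Σ_y p(x,y,z), p_{YZ}(y,z) = Σ_x p(x,y,z), one has I(X:Y|Z) := Σ_{(x,y,z) : p(x,y,z) > 0} p(x,y,z) · log₂( p(x,y,z)·p_Z(z) / (p_{XZ}(x,z)·p_{YZ}(y,z)) ) = h(λ), where h(λ) = −λ·log₂ λ − (1−λ)·log₂(1−λ). (Proposition 1, part 4.) -/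
/-- Eve's marginal `p_Z` of the origami distribution. -/
noncomputable def origamiMargZ (n : ℕ) (lam : ℝ) (z : ℕ) : ℝ :=
  ∑' x : ℕ, ∑' y : ℕ, origamiB n lam (x, y, z)

/-- The `(X,Z)`-marginal `p_{XZ}` of the origami distribution. -/
noncomputable def origamiMargXZ (n : ℕ) (lam : ℝ) (x z : ℕ) : ℝ :=
  ∑' y : ℕ, origamiB n lam (x, y, z)

/-- The `(Y,Z)`-marginal `p_{YZ}` of the origami distribution. -/
noncomputable def origamiMargYZ (n : ℕ) (lam : ℝ) (y z : ℕ) : ℝ :=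
  ∑' x : ℕ, origamiB n lam (x, y, z)

/-- Every slice `z < N` of `s` has exactly two points, whose first coordinates have opposite
parities, as do their second coordinates; all other slices are empty. -/
def OrigamiPaired (s : Finset (ℕ × ℕ × ℕ)) (N : ℕ) : Prop :=
  ∃ a b c d : ℕ → ℕ,
    (∀ z, a z % 2 = 0 ∧ c z % 2 = 1 ∧ b z % 2 ≠ d z % 2) ∧
    ∀ x y z, (x, y, z) ∈ s ↔ z < N ∧ (x = a z ∧ y = b z ∨ x = c z ∧ y = d z)

theorem origamiSig_mod_two {t : ℕ} (ht : t % 2 = 0) (k : ℕ) : origamiSig t k % 2 = k % 2 := by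
  unfold origamiSig
  split_ifs with h1 h2
  · omega
  · have := Nat.mod_le k (2 * t)
    omega
  · rfl

theorem OrigamiPaired.union_image {s : Finset (ℕ × ℕ × ℕ)} {N : ℕ} (hs : OrigamiPaired s N)
    {f g : ℕ → ℕ} (hf : ∀ k, f k % 2 = k % 2) (hg : ∀ k, g k % 2 = k % 2) :
    OrigamiPaired (s ∪ s.image (fun p => (f p.1, g p.2.1, p.2.2 + N))) (2 * N) := by
  obtain ⟨a, b, c, d, hpar, hmem⟩ := hs
  refine ⟨fun z => if z < N then a z else f (a (z - N)),
    fun z => if z < N then b z else g (b (z - N)),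
    fun z => if z < N then c z else f (c (z - N)),
    fun z => if z < N then d z else g (d (z - N)), ?_, ?_⟩
  · intro z
    by_cases hz : z < N
    · simpa only [hz, if_true] using hpar z
    · simpa only [hz, if_false, hf, hg] using hpar (z - N)
  · intro x y z
    simp only [Finset.mem_union, Finset.mem_image, Prod.exists, Prod.mk.injEq, hmem]
    by_cases hz : z < N
    · simp only [hz, if_true, true_and]
      constructor
      · rintro (h | ⟨u, v, w, -, -, -, h⟩)
        · exact ⟨by omega, h⟩
        · omega
      · exact fun h => Or.inl h.2
    · simp only [hz, if_false, false_and, false_or]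
      constructor
      · rintro ⟨u, v, w, ⟨hw, h⟩, rfl, rfl, rfl⟩
        rw [Nat.add_sub_cancel]
        refine ⟨by omega, ?_⟩
        rcases h with ⟨rfl, rfl⟩ | ⟨rfl, rfl⟩ <;> simp
      · rintro ⟨hz2, ⟨rfl, rfl⟩ | ⟨rfl, rfl⟩⟩
        · exact ⟨_, _, z - N, ⟨by omega, Or.inl ⟨rfl, rfl⟩⟩, rfl, rfl, by omega⟩
        · exact ⟨_, _, z - N, ⟨by omega, Or.inr ⟨rfl, rfl⟩⟩, rfl, rfl, by omega⟩

theorem two_pow_mod_two {m : ℕ} (hm : m ≠ 0) : 2 ^ m % 2 = 0 :=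
  Nat.mod_eq_zero_of_dvd (dvd_pow_self 2 hm)

theorem OrigamiPaired.union_origamiFold {s : Finset (ℕ × ℕ × ℕ)} {n : ℕ}
    (hs : OrigamiPaired s (2 ^ (n + 1))) :
    OrigamiPaired (s ∪ origamiFold n s) (2 ^ (n + 2)) := by
  have hshift {m : ℕ} (hm : m ≠ 0) (k : ℕ) : (k + 2 ^ m) % 2 = k % 2 := by
    have := two_pow_mod_two hm
    omega
  have hsig {m : ℕ} (hm : m ≠ 0) := origamiSig_mod_two (two_pow_mod_two hm)
  rw [pow_succ' 2 (n + 1)]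
  unfold origamiFold
  split_ifs with h
  · exact hs.union_image (f := fun k => k + 2 ^ ((n + 3) / 2))
      (g := origamiSig (2 ^ ((n + 1) / 2))) (hshift (by omega)) (hsig (by omega))
  · exact hs.union_image (f := origamiSig (2 ^ (n / 2 + 1)))
      (g := fun k => k + 2 ^ (n / 2 + 1)) (hsig (by omega)) (hshift (by omega))

theorem origamiPaired_origamiS {n : ℕ} (hn : 1 ≤ n) :
    OrigamiPaired (origamiS n) (2 ^ (n + 1)) := by
  induction n, hn using Nat.le_induction with
  | base =>
    refine ⟨fun z => if z = 1 ∨ z = 3 then 2 else 0,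
      fun z => if z = 0 then 0 else if z = 1 then 1 else if z = 2 then 2 else 3,
      fun z => if z = 0 ∨ z = 3 then 1 else 3,
      fun z => if z = 0 then 1 else if z = 1 then 0 else if z = 2 then 3 else 2, ?_, ?_⟩
    · intro z
      dsimp only
      split_ifs <;> omega
    · intro x y z
      simp only [origamiS, Finset.mem_insert, Finset.mem_singleton, Prod.mk.injEq]
      by_cases hz : z < 4
      · interval_cases z <;> simp <;> omega
      · omega
  | succ n hn ih =>
    obtain ⟨m, rfl⟩ : ∃ m, n = m + 1 := ⟨n - 1, by omega⟩
    exact ih.union_origamiFold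

/-- A finite set with paired slices is the disjoint union of two graphs over `range N`. -/
theorem sum_eq_sum_range_of_mem_iff {s : Finset (ℕ × ℕ × ℕ)} {N : ℕ} {a b c d : ℕ → ℕ}
    (hac : ∀ z, a z ≠ c z)
    (hmem : ∀ x y z, (x, y, z) ∈ s ↔ z < N ∧ (x = a z ∧ y = b z ∨ x = c z ∧ y = d z))
    (F : ℕ × ℕ × ℕ → ℝ) :
    ∑ p ∈ s, F p = ∑ z ∈ Finset.range N, (F (a z, b z, z) + F (c z, d z, z)) := by
  have hs : s = (Finset.range N).image (fun z => (a z, b z, z)) ∪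
      (Finset.range N).image (fun z => (c z, d z, z)) := by
    ext ⟨x, y, z⟩
    simp only [hmem, Finset.mem_union, Finset.mem_image, Finset.mem_range, Prod.mk.injEq]
    constructor
    · rintro ⟨hz, ⟨rfl, rfl⟩ | ⟨rfl, rfl⟩⟩
      · exact Or.inl ⟨z, hz, rfl, rfl, rfl⟩
      · exact Or.inr ⟨z, hz, rfl, rfl, rfl⟩
    · rintro (⟨w, hw, rfl, rfl, rfl⟩ | ⟨w, hw, rfl, rfl, rfl⟩) <;> simp [hw]
  have hdisj : Disjoint ((Finset.range N).image (fun z => (a z, b z, z)))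
      ((Finset.range N).image (fun z => (c z, d z, z))) := by
    rw [Finset.disjoint_left]
    intro p hp hq
    simp only [Finset.mem_image] at hp hq
    obtain ⟨z, -, rfl⟩ := hp
    obtain ⟨w, -, h⟩ := hq
    simp only [Prod.mk.injEq] at h
    obtain ⟨h1, -, rfl⟩ := h
    exact hac w h1.symm
  rw [hs, Finset.sum_union hdisj, Finset.sum_image (fun _ _ _ _ h => (Prod.ext_iff.1 (Prod.ext_iff.1 h).2).2),
    Finset.sum_image (fun _ _ _ _ h => (Prod.ext_iff.1 (Prod.ext_iff.1 h).2).2),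
    Finset.sum_add_distrib]


open scoped Classical in
/-- **Proposition 1, part 4.** For every `n ≥ 1` and `0 < λ < 1`, the conditional mutual
information `I(X:Y|Z)` of the origami distribution `b^{(n,λ)}` equals the binary
entropy `h(λ) = -λ log₂ λ - (1-λ) log₂ (1-λ)`. -/
theorem origami_conditional_mutual_information
    (n : ℕ) (hn : 1 ≤ n) (lam : ℝ) (hlam0 : 0 < lam) (hlam1 : lam < 1) :
    (∑' p : ℕ × ℕ × ℕ,
      if 0 < origamiB n lam p then
        origamiB n lam p *
          Real.logb 2 (origamiB n lam p * origamiMargZ n lam p.2.2 /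
            (origamiMargXZ n lam p.1 p.2.2 * origamiMargYZ n lam p.2.1 p.2.2))
      else 0)
    = -lam * Real.logb 2 lam - (1 - lam) * Real.logb 2 (1 - lam) := by
  obtain ⟨a, b, c, d, hpar, hmem⟩ := origamiPaired_origamiS hn
  have hac (z : ℕ) : a z ≠ c z := fun h => by have := hpar z; omega
  have hbd (z : ℕ) : b z ≠ d z := fun h => (hpar z).2.2 (by rw [h])
  set N : ℕ := 2 ^ (n + 1) with hN
  have hNpos : (0 : ℝ) < N := by rw [hN]; positivity
  have hB (x y z : ℕ) : origamiB n lam (x, y, z) =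
      if z < N ∧ (x = a z ∧ y = b z ∨ x = c z ∧ y = d z) then
        (if x % 2 = 0 then lam else 1 - lam) / N else 0 := by
    simp only [origamiB, hmem, hN, Nat.cast_pow, Nat.cast_ofNat]
  have hBa {z : ℕ} (hz : z < N) : origamiB n lam (a z, b z, z) = lam / N := by
    simp [hB, hz, (hpar z).1]
  have hBc {z : ℕ} (hz : z < N) : origamiB n lam (c z, d z, z) = (1 - lam) / N := by
    simp [hB, hz, (hpar z).2.1]
  have hXZa {z : ℕ} (hz : z < N) : origamiMargXZ n lam (a z) z = lam / N := by
    rw [origamiMargXZ, tsum_eq_single (b z) (fun y hy => by simp [hB, hac, hy]), hBa hz]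
  have hXZc {z : ℕ} (hz : z < N) : origamiMargXZ n lam (c z) z = (1 - lam) / N := by
    rw [origamiMargXZ, tsum_eq_single (d z) (fun y hy => by simp [hB, (hac z).symm, hy]), hBc hz]
  have hYZb {z : ℕ} (hz : z < N) : origamiMargYZ n lam (b z) z = lam / N := by
    rw [origamiMargYZ, tsum_eq_single (a z) (fun x hx => by simp [hB, hbd, hx]), hBa hz]
  have hYZd {z : ℕ} (hz : z < N) : origamiMargYZ n lam (d z) z = (1 - lam) / N := by
    rw [origamiMargYZ, tsum_eq_single (c z) (fun x hx => by simp [hB, (hbd z).symm, hx]), hBc hz]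
  have hZ {z : ℕ} (hz : z < N) : origamiMargZ n lam z = 1 / N := by
    change ∑' x, origamiMargXZ n lam x z = _
    rw [tsum_eq_sum (s := {a z, c z}), Finset.sum_pair (hac z), hXZa hz, hXZc hz]
    · ring
    · intro x hx
      simp only [Finset.mem_insert, Finset.mem_singleton, not_or] at hx
      simp [origamiMargXZ, hB, hx]
  have hterm {q : ℝ} (hq : 0 < q) :
      q / N * Real.logb 2 (q / N * (1 / N) / (q / N * (q / N))) = -(q * Real.logb 2 q) / N := by
    have : q / N * (1 / N) / (q / N * (q / N)) = q⁻¹ := by field_simp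
    rw [this, Real.logb_inv]
    ring
  have h1lam : 0 < 1 - lam := sub_pos.2 hlam1
  rw [tsum_eq_sum (s := origamiS n) (fun p hp => by simp [origamiB, hp]),
    sum_eq_sum_range_of_mem_iff hac hmem,
    Finset.sum_congr rfl (g := fun _ =>
      -(lam * Real.logb 2 lam) / N + -((1 - lam) * Real.logb 2 (1 - lam)) / N)]
  · rw [Finset.sum_const, Finset.card_range, nsmul_eq_mul]
    field_simp
    ring
  · intro z hz
    have hz := Finset.mem_range.1 hz
    simp only [hBa hz, hBc hz, hXZa hz, hXZc hz, hYZb hz, hYZd hz, hZ hz]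
    rw [if_pos (div_pos hlam0 hNpos), if_pos (div_pos h1lam hNpos), hterm hlam0, hterm h1lam]
end

section
/- Let 𝒳, 𝒴, 𝒵, ℳ be finite sets, p a probability distribution on 𝒳×𝒴×𝒵, and c : 𝒳×ℳ → [0,1] a channel with Σ_{m∈ℳ} c(x,m) = 1 for every x ∈ 𝒳. Define the distribution q on 𝒳×𝒴×(𝒵×ℳ) by q(x,y,(z,m)) = p(x,y,z)·c(x,m), i.e., Alice broadcasts a public message M generated from X which is appended to Eve's variable. Then Srk(q) ≤ Srk(p). (Equation (SrkMonotone): the secrecy rank is an LOPC monotone under public announcement of a locally generated message.) -/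
open scoped Classical in
/-- The **secrecy rank** of a probability distribution `p` on `𝒳 × 𝒴 × 𝒵`: the minimum,
over all `m ≥ 1` and all extensions `q` of `p` by an auxiliary variable `W` with values
in `Fin m` making `X` and `Y` conditionally independent given `(Z,W)`, of the maximum
over `z` in the support of the `Z`-marginal of the number of values `w` with
`q_{ZW}(z,w) > 0`. -/
noncomputable def Srk {X Y Z : Type*} [Fintype X] [Fintype Y] [Fintype Z]
    (p : X → Y → Z → ℝ) : ℕ :=
  sInf { r : ℕ | ∃ m : ℕ, 1 ≤ m ∧ ∃ q : X → Y → Z → Fin m → ℝ,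
    (∀ x y z w, 0 ≤ q x y z w) ∧
    (∀ x y z, ∑ w, q x y z w = p x y z) ∧
    (∀ x y z w, q x y z w * (∑ x', ∑ y', q x' y' z w) =
      (∑ y', q x y' z w) * (∑ x', q x' y z w)) ∧
    r = (Finset.univ.filter fun z : Z => 0 < ∑ x, ∑ y, p x y z).sup
      (fun z => (Finset.univ.filter fun w : Fin m => 0 < ∑ x, ∑ y, q x y z w).card) }

/-- A weight factorizing as `q x y * T = A x * B y` with `T` its total mass and `A`, `B` its
marginals still does so after multiplication by a function of `x` alone. -/
lemma factorization_mul_left {X Y : Type*} [Fintype X] [Fintype Y] {q : X → Y → ℝ}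
    (hq0 : ∀ x y, 0 ≤ q x y)
    (hq : ∀ x y, q x y * (∑ x', ∑ y', q x' y') = (∑ y', q x y') * (∑ x', q x' y))
    (c : X → ℝ) (x : X) (y : Y) :
    q x y * c x * (∑ x', ∑ y', q x' y' * c x') =
      (∑ y', q x y' * c x) * (∑ x', q x' y * c x') := by
  by_cases hT : (∑ x', ∑ y', q x' y') = 0
  · have hzero : ∀ x y, q x y = 0 := fun x y => by
      have hx := (Finset.sum_eq_zero_iff_of_nonneg
        fun x _ => Finset.sum_nonneg fun y _ => hq0 x y).1 hT x (Finset.mem_univ x)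
      exact (Finset.sum_eq_zero_iff_of_nonneg fun y _ => hq0 x y).1 hx y (Finset.mem_univ y)
    simp [hzero]
  · apply mul_left_cancel₀ hT
    have hcol : (∑ x', ∑ y', q x' y') * ∑ x', q x' y * c x' =
        (∑ x', q x' y) * ∑ x', ∑ y', q x' y' * c x' := by
      rw [Finset.mul_sum, Finset.mul_sum]
      refine Finset.sum_congr rfl fun x' _ => ?_
      rw [← Finset.sum_mul]
      linear_combination c x' * hq x' y
    rw [← Finset.sum_mul]
    linear_combination (c x * ∑ x', ∑ y', q x' y' * c x') * hq x y -
      ((∑ y', q x y') * c x) * hcol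

/-- Multiplying by a nonnegative weight does not enlarge the event of positive mass. -/
lemma sum_sum_pos_of_sum_sum_mul_pos {X Y : Type*} [Fintype X] [Fintype Y] {q : X → Y → ℝ}
    (hq0 : ∀ x y, 0 ≤ q x y) {c : X → ℝ} (h : 0 < ∑ x, ∑ y, q x y * c x) :
    0 < ∑ x, ∑ y, q x y := by
  have hnonneg : ∀ x, 0 ≤ ∑ y, q x y := fun x => Finset.sum_nonneg fun y _ => hq0 x y
  refine (Finset.sum_nonneg fun x _ => hnonneg x).lt_of_ne fun h0 => h.ne' ?_
  refine Finset.sum_eq_zero fun x _ => ?_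
  rw [← Finset.sum_mul, (Finset.sum_eq_zero_iff_of_nonneg fun x _ => hnonneg x).1 h0.symm x
    (Finset.mem_univ x), zero_mul]

open scoped Classical in
/-- Taking `W = X` gives an extension making `X` and `Y` conditionally independent. -/
lemma exists_condIndep_extension {X Y Z : Type*} [Fintype X] [Fintype Y] [Fintype Z] [Nonempty X]
    {p : X → Y → Z → ℝ} (hp0 : ∀ x y z, 0 ≤ p x y z) :
    ∃ m : ℕ, 1 ≤ m ∧ ∃ q : X → Y → Z → Fin m → ℝ,
      (∀ x y z w, 0 ≤ q x y z w) ∧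
      (∀ x y z, ∑ w, q x y z w = p x y z) ∧
      (∀ x y z w, q x y z w * (∑ x', ∑ y', q x' y' z w) =
        (∑ y', q x y' z w) * (∑ x', q x' y z w)) := by
  let e := Fintype.equivFin X
  refine ⟨Fintype.card X, Fintype.card_pos,
    fun x y z w => if x = e.symm w then p x y z else 0, ?_, ?_, ?_⟩
  · intro x y z w
    dsimp only
    split_ifs
    exacts [hp0 x y z, le_rfl]
  · intro x y z
    simp [Equiv.eq_symm_apply]
  · intro x y z w
    rw [Finset.sum_comm (s := Finset.univ (α := X))]
    by_cases h : x = e.symm w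
    · simp [h, mul_comm]
    · simp [h]

/-- **Monotonicity of the secrecy rank under public announcement** (Eq. (SrkMonotone)):
if Alice broadcasts a public message `M` generated from `X` through a channel `c`, and
the message is appended to Eve's variable, the secrecy rank does not increase. -/
theorem secrecy_rank_LOPC_monotone
    {X Y Z M : Type} [Fintype X] [Fintype Y] [Fintype Z] [Fintype M]
    (p : X → Y → Z → ℝ)
    (hp0 : ∀ x y z, 0 ≤ p x y z) (hp1 : ∑ x, ∑ y, ∑ z, p x y z = 1)
    (c : X → M → ℝ)
    (hc0 : ∀ x m, 0 ≤ c x m) (hc1 : ∀ x m, c x m ≤ 1) (hcsum : ∀ x, ∑ m, c x m = 1) :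
    Srk (fun (x : X) (y : Y) (zm : Z × M) => p x y zm.1 * c x zm.2) ≤ Srk p := by
  classical
  have : Nonempty X := by
    by_contra h
    rw [not_nonempty_iff] at h
    simp at hp1
  obtain ⟨m₀, hm₀, q₀, h₀, hsum₀, hind₀⟩ := exists_condIndep_extension hp0
  unfold Srk
  refine le_csInf ⟨_, m₀, hm₀, q₀, h₀, hsum₀, hind₀, rfl⟩ ?_
  rintro r ⟨m, hm, q, hq0, hqsum, hqind, rfl⟩
  refine le_trans (Nat.sInf_le ⟨m, hm, fun x y zm w => q x y zm.1 w * c x zm.2,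
    fun x y zm w => mul_nonneg (hq0 x y zm.1 w) (hc0 x zm.2), ?_, ?_, rfl⟩) ?_
  · intro x y zm
    rw [← Finset.sum_mul, hqsum]
  · intro x y zm w
    exact factorization_mul_left (fun x y => hq0 x y zm.1 w)
      (fun x y => hqind x y zm.1 w) (fun x => c x zm.2) x y
  · refine Finset.sup_le fun zm hzm => ?_
    have hz : zm.1 ∈ Finset.univ.filter fun z : Z => 0 < ∑ x, ∑ y, p x y z :=
      Finset.mem_filter.2 ⟨Finset.mem_univ _, sum_sum_pos_of_sum_sum_mul_pos
        (fun x y => hp0 x y zm.1) (Finset.mem_filter.1 hzm).2⟩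
    refine le_trans (Finset.card_le_card fun w hw => ?_) (Finset.le_sup
      (f := fun z => (Finset.univ.filter fun w : Fin m => 0 < ∑ x, ∑ y, q x y z w).card) hz)
    exact Finset.mem_filter.2 ⟨Finset.mem_univ _, sum_sum_pos_of_sum_sum_mul_pos
      (fun x y => hq0 x y zm.1 w) (Finset.mem_filter.1 hw).2⟩
end
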